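/- Generating function for doubled shifted plane partitions of width m: for every integer m ≥ 1, Σ_{ω ∈ DSPP_m} z^{|ω|} = ∏_{k≥1} (1−z^k)^{−1} · ∏_{k≥0} ∏_{1≤i<j≤m−1} (1−z^{2mk+i+j})^{−1}, as an identity of formal power series in z, where DSPP_m is the set of all skew doubled shifted plane partitions with profile δ = (−1,−1,...,−1) of length m−1. -/

import Mathlib

open scoped BigOperators

/-- An integer partition: a weakly decreasing, finitely supported sequence of
nonnegative integers. -/
structure Ptn where
  toFun : ℕ →₀ ℕ
  antitone' : ∀ ⦃i j : ℕ⦄, i ≤ j → toFun j ≤ toFun i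

namespace Ptn
/-- the `i`-th part (0-indexed) -/
def part (lam : Ptn) (i : ℕ) : ℕ := lam.toFun i
/-- the size `|λ|` -/
def size (lam : Ptn) : ℕ := lam.toFun.sum fun _ k => k
end Ptn

/-- `HStrip μ λ` means `μ ≺ λ`, i.e. `λ/μ` is a horizontal strip:
`λ_i ≥ μ_i ≥ λ_{i+1}` for all `i`. -/
def HStrip (mu lam : Ptn) : Prop :=
  ∀ i : ℕ, mu.part i ≤ lam.part i ∧ lam.part (i + 1) ≤ mu.part i
/-- `δ` is a `±1`-profile on the indices `1, …, h` -/
def IsProfile (h : ℕ) (δ : ℕ → ℤ) : Prop := ∀ i, 1 ≤ i → i ≤ h → δ i = 1 ∨ δ i = -1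

/-- A skew doubled shifted plane partition `ω = (λ^0, …, λ^{m-1})` with profile
`(δ_1, …, δ_{m-1})`: if `δ_{i+1} = 1` then `λ^i ≺ λ^{i+1}`, and if
`δ_{i+1} = -1` then `λ^i ≻ λ^{i+1}`. -/
def IsDSPP (m : ℕ) (δ : ℕ → ℤ) (L : Fin m → Ptn) : Prop :=
  ∀ (i : ℕ) (hi : i + 1 < m),
    if δ (i + 1) = 1 then HStrip (L ⟨i, Nat.lt_of_succ_lt hi⟩) (L ⟨i + 1, hi⟩)
    else HStrip (L ⟨i + 1, hi⟩) (L ⟨i, Nat.lt_of_succ_lt hi⟩)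
/-- the coefficientwise (product) topology on formal power series -/
instance : TopologicalSpace (PowerSeries ℚ) :=
  inferInstanceAs (TopologicalSpace ((Unit →₀ ℕ) → ℚ))

/-- the formal variable `z` -/
noncomputable def z : PowerSeries ℚ := PowerSeries.X

namespace Ptn

@[ext]
theorem ext {lam mu : Ptn} (h : ∀ i, lam.part i = mu.part i) : lam = mu := by
  cases lam
  cases mu
  congr
  exact Finsupp.ext h

theorem part_succ_le (lam : Ptn) (i : ℕ) : lam.part (i + 1) ≤ lam.part i :=
  lam.antitone' (Nat.le_succ i)

theorem exists_bound (lam : Ptn) : ∃ N, ∀ i, N ≤ i → lam.part i = 0 := by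
  refine ⟨lam.toFun.support.sup id + 1, fun i hi => ?_⟩
  by_contra h
  have := Finset.le_sup (f := id) (Finsupp.mem_support_iff.mpr h)
  simp only [id] at this
  omega

theorem size_eq_sum_range (lam : Ptn) {N : ℕ} (hN : ∀ i, N ≤ i → lam.part i = 0) :
    lam.size = ∑ i ∈ Finset.range N, lam.part i := by
  refine Finsupp.sum_of_support_subset _ (fun i hi => ?_) _ (fun _ _ => rfl)
  by_contra h
  exact Finsupp.mem_support_iff.mp hi (hN i (by simpa using h))

/-- The partition with parts `f 0, f 1, …`, for an antitone `f` dominated by the parts of `lam`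
up to a shift of the index. -/
noncomputable def ofFun (f : ℕ → ℕ) (hf : ∀ i, f (i + 1) ≤ f i)
    (lam : Ptn) (h : ∀ i, f (i + 1) ≤ lam.part i) : Ptn where
  toFun := Finsupp.onFinset (Finset.range (lam.exists_bound.choose + 1)) f fun i hi => by
    by_contra hi'
    obtain ⟨j, rfl⟩ := Nat.exists_eq_add_one_of_ne_zero (n := i) (by rintro rfl; simp at hi')
    have := h j
    rw [lam.exists_bound.choose_spec j (by simp at hi'; omega)] at this
    omega
  antitone' := antitone_nat_of_succ_le hf

@[simp]
theorem part_ofFun (f : ℕ → ℕ) (hf : ∀ i, f (i + 1) ≤ f i)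
    (lam : Ptn) (h : ∀ i, f (i + 1) ≤ lam.part i) (i : ℕ) :
    (ofFun f hf lam h).part i = f i := rfl

end Ptn

theorem HStrip.size_le {mu lam : Ptn} (h : HStrip mu lam) : mu.size ≤ lam.size := by
  obtain ⟨N, hN⟩ := lam.exists_bound
  have hN' : ∀ i, N ≤ i → mu.part i = 0 := fun i hi =>
    Nat.eq_zero_of_le_zero ((h i).1.trans (hN i hi).le)
  rw [lam.size_eq_sum_range hN, mu.size_eq_sum_range hN']
  exact Finset.sum_le_sum fun i _ => (h i).1

/-- The parts of the partition above `α` and `β` whose toggle is `(k, nu)`. -/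
def raiseParts (α β nu : Ptn) (k : ℕ) : ℕ → ℕ
  | 0 => max (α.part 0) (β.part 0) + k
  | j + 1 => min (α.part j) (β.part j) + max (α.part (j + 1)) (β.part (j + 1)) - nu.part j

/-- The local toggle: partitions above both `α` and `β` correspond to partitions below both of
them, together with a nonnegative integer. -/
noncomputable def toggle (α β : Ptn) :
    {lam // HStrip α lam ∧ HStrip β lam} ≃ ℕ × {nu // HStrip nu α ∧ HStrip nu β} where
  toFun lam :=
    ⟨lam.1.part 0 - max (α.part 0) (β.part 0),
      Ptn.ofFun (fun i => min (α.part i) (β.part i) + max (α.part (i + 1)) (β.part (i + 1)) -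
          lam.1.part (i + 1))
        (fun i => by
          have h1 := lam.2.1 i
          have h2 := lam.2.2 i
          have h3 := lam.2.1 (i + 1)
          have h4 := lam.2.2 (i + 1)
          have h5 := lam.2.1 (i + 1 + 1)
          have h6 := lam.2.2 (i + 1 + 1)
          omega) α
        (fun i => by
          have h1 := lam.2.1 (i + 1)
          have h2 := lam.2.2 (i + 1)
          have h3 := α.part_succ_le i
          have h5 := lam.2.1 (i + 1 + 1)
          have h6 := lam.2.2 (i + 1 + 1)
          omega),
      fun i => by
        have h1 := lam.2.1 i
        have h2 := lam.2.2 i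
        have h3 := lam.2.1 (i + 1)
        have h4 := lam.2.2 (i + 1)
        simp only [Ptn.part_ofFun]
        omega,
      fun i => by
        have h1 := lam.2.1 i
        have h2 := lam.2.2 i
        have h3 := lam.2.1 (i + 1)
        have h4 := lam.2.2 (i + 1)
        simp only [Ptn.part_ofFun]
        omega⟩
  invFun p :=
    ⟨Ptn.ofFun (raiseParts α β p.2.1 p.1)
        (fun i => by
          cases i with
          | zero =>
            have h1 := p.2.2.1 0
            have h2 := p.2.2.2 0
            simp only [raiseParts]
            omega
          | succ j =>
            have h1 := p.2.2.1 j
            have h2 := p.2.2.2 j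
            have h3 := p.2.2.1 (j + 1)
            have h4 := p.2.2.2 (j + 1)
            simp only [raiseParts]
            omega) α
        (fun i => by
          have h1 := p.2.2.1 i
          have h2 := p.2.2.2 i
          simp only [raiseParts]
          omega),
      fun i => by
        have h1 := p.2.2.1 i
        have h2 := p.2.2.2 i
        cases i with
        | zero =>
          simp only [Ptn.part_ofFun, raiseParts]
          omega
        | succ j =>
          have h3 := p.2.2.1 j
          have h4 := p.2.2.2 j
          simp only [Ptn.part_ofFun, raiseParts]
          omega,
      fun i => by
        have h1 := p.2.2.1 i
        have h2 := p.2.2.2 i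
        cases i with
        | zero =>
          simp only [Ptn.part_ofFun, raiseParts]
          omega
        | succ j =>
          have h3 := p.2.2.1 j
          have h4 := p.2.2.2 j
          simp only [Ptn.part_ofFun, raiseParts]
          omega⟩
  left_inv lam := by
    refine Subtype.ext (Ptn.ext fun i => ?_)
    cases i with
    | zero =>
      have h1 := lam.2.1 0
      have h2 := lam.2.2 0
      simp only [Ptn.part_ofFun, raiseParts]
      omega
    | succ j =>
      have h1 := lam.2.1 j
      have h2 := lam.2.2 j
      have h3 := lam.2.1 (j + 1)
      have h4 := lam.2.2 (j + 1)
      simp only [Ptn.part_ofFun, raiseParts]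
      omega
  right_inv p := by
    refine Prod.ext ?_ (Subtype.ext (Ptn.ext fun i => ?_))
    · simp [raiseParts]
    · have h1 := p.2.2.1 i
      have h2 := p.2.2.2 i
      simp only [Ptn.part_ofFun, raiseParts]
      omega

theorem size_add_size_toggle (α β : Ptn) (lam : {lam // HStrip α lam ∧ HStrip β lam}) :
    lam.1.size + (toggle α β lam).2.1.size = α.size + β.size + (toggle α β lam).1 := by
  obtain ⟨A, hA⟩ := α.exists_bound
  obtain ⟨B, hB⟩ := β.exists_bound
  set N := A + B with hN
  have hα : ∀ i, N ≤ i → α.part i = 0 := fun i hi => hA i (by omega)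
  have hβ : ∀ i, N ≤ i → β.part i = 0 := fun i hi => hB i (by omega)
  have hlam : ∀ i, N + 1 ≤ i → lam.1.part i = 0 := fun i hi => by
    obtain ⟨j, rfl⟩ := Nat.exists_eq_add_of_le' hi
    have h1 := (lam.2.1 (j + N)).2
    rw [hα (j + N) (by omega)] at h1
    rw [← add_assoc]
    omega
  have hnu : ∀ i, N ≤ i → (toggle α β lam).2.1.part i = 0 := fun i hi => by
    have h1 := ((toggle α β lam).2.2.1 i).1
    rw [hα i hi] at h1
    omega
  have h0 : (toggle α β lam).1 = lam.1.part 0 - max (α.part 0) (β.part 0) := rfl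
  have hmax : ∑ i ∈ Finset.range N, max (α.part (i + 1)) (β.part (i + 1)) +
      max (α.part 0) (β.part 0) = ∑ i ∈ Finset.range N, max (α.part i) (β.part i) := by
    rw [← Finset.sum_range_succ' (fun i => max (α.part i) (β.part i)), Finset.sum_range_succ,
      hα N le_rfl, hβ N le_rfl, max_self, add_zero]
  have hsum : ∑ i ∈ Finset.range N, lam.1.part (i + 1) +
        ∑ i ∈ Finset.range N, (toggle α β lam).2.1.part i =
      ∑ i ∈ Finset.range N, min (α.part i) (β.part i) +
        ∑ i ∈ Finset.range N, max (α.part (i + 1)) (β.part (i + 1)) := by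
    rw [← Finset.sum_add_distrib, ← Finset.sum_add_distrib]
    refine Finset.sum_congr rfl fun i _ => ?_
    have h1 := lam.2.1 i
    have h2 := lam.2.2 i
    have h3 : (toggle α β lam).2.1.part i = min (α.part i) (β.part i) +
      max (α.part (i + 1)) (β.part (i + 1)) - lam.1.part (i + 1) := rfl
    omega
  have hmm : ∑ i ∈ Finset.range N, min (α.part i) (β.part i) +
        ∑ i ∈ Finset.range N, max (α.part i) (β.part i) =
      ∑ i ∈ Finset.range N, α.part i + ∑ i ∈ Finset.range N, β.part i := by
    rw [← Finset.sum_add_distrib, ← Finset.sum_add_distrib]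
    exact Finset.sum_congr rfl fun i _ => min_add_max _ _
  have h1 := lam.2.1 0
  have h2 := lam.2.2 0
  rw [lam.1.size_eq_sum_range hlam, α.size_eq_sum_range hα, β.size_eq_sum_range hβ,
    (toggle α β lam).2.1.size_eq_sum_range hnu, Finset.sum_range_succ', h0]
  omega

section FormalSums

variable {ι κ : Type*}

/-- The coefficientwise sum of an arbitrary family of power series over `ℝ≥0∞`. -/
noncomputable def fsum (f : ι → PowerSeries ENNReal) : PowerSeries ENNReal :=
  PowerSeries.mk fun n => ∑' i, PowerSeries.coeff n (f i)

theorem coeff_fsum (f : ι → PowerSeries ENNReal) (n : ℕ) :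
    PowerSeries.coeff n (fsum f) = ∑' i, PowerSeries.coeff n (f i) :=
  PowerSeries.coeff_mk _ _

theorem fsum_comm (f : ι → κ → PowerSeries ENNReal) :
    fsum (fun i => fsum (f i)) = fsum fun j => fsum fun i => f i j := by
  ext n
  simp only [coeff_fsum]
  exact ENNReal.tsum_comm

theorem fsum_prod (f : ι × κ → PowerSeries ENNReal) :
    fsum f = fsum fun i => fsum fun j => f (i, j) := by
  ext n
  simp only [coeff_fsum]
  exact ENNReal.tsum_prod'

theorem fsum_equiv (e : ι ≃ κ) (f : κ → PowerSeries ENNReal) :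
    fsum (fun i => f (e i)) = fsum f := by
  ext n
  simp only [coeff_fsum]
  exact e.tsum_eq fun j => PowerSeries.coeff n (f j)

theorem mul_fsum (a : PowerSeries ENNReal) (f : ι → PowerSeries ENNReal) :
    a * fsum f = fsum fun i => a * f i := by
  ext n
  simp only [coeff_fsum, PowerSeries.coeff_mul]
  rw [Summable.tsum_finsetSum fun _ _ => ENNReal.summable]
  simp only [ENNReal.tsum_mul_left]

theorem fsum_mul (a : PowerSeries ENNReal) (f : ι → PowerSeries ENNReal) :
    fsum f * a = fsum fun i => f i * a := by
  simp only [mul_comm _ a, mul_fsum]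

theorem fsum_subtype (p : ι → Prop) [DecidablePred p] (f : ι → PowerSeries ENNReal) :
    fsum (fun i => if p i then f i else 0) = fsum fun i : {i // p i} => f i := by
  ext n
  simp only [coeff_fsum]
  refine Eq.trans (tsum_congr fun i => ?_)
    (tsum_subtype {i | p i} fun i => PowerSeries.coeff n (f i)).symm
  by_cases h : p i <;> simp [h]

/-- The geometric series `∑ₖ X ^ (e k)`. -/
noncomputable def geom (e : ℕ) : PowerSeries ENNReal :=
  fsum fun k : ℕ => PowerSeries.X ^ (e * k)

end FormalSums

section Operators

open Classical in
/-- The matrix entry of the half-vertex operators: `X ^ (e (|lam| - |mu|))` if `mu ≺ lam`. -/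
noncomputable def kernel (e : ℕ) (mu lam : Ptn) : PowerSeries ENNReal :=
  if HStrip mu lam then PowerSeries.X ^ (e * (lam.size - mu.size)) else 0

/-- The commutation relation of the half-vertex operators, entry by entry. -/
theorem fsum_kernel_mul_kernel (a b : ℕ) (α β : Ptn) :
    fsum (fun lam => kernel a β lam * kernel b α lam) =
      geom (a + b) * fsum fun nu => kernel b nu β * kernel a nu α := by
  classical
  have hup : ∀ lam, kernel a β lam * kernel b α lam =
      if HStrip α lam ∧ HStrip β lam then
        (PowerSeries.X ^ (a * (lam.size - β.size) + b * (lam.size - α.size)) :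
          PowerSeries ENNReal) else 0 := fun lam => by
    by_cases h1 : HStrip α lam <;> by_cases h2 : HStrip β lam <;> simp [kernel, h1, h2, pow_add]
  have hdown : ∀ nu, kernel b nu β * kernel a nu α =
      if HStrip nu α ∧ HStrip nu β then
        (PowerSeries.X ^ (b * (β.size - nu.size) + a * (α.size - nu.size)) :
          PowerSeries ENNReal) else 0 := fun nu => by
    by_cases h1 : HStrip nu α <;> by_cases h2 : HStrip nu β <;> simp [kernel, h1, h2, pow_add]
  simp only [hup, hdown]
  rw [fsum_subtype, fsum_subtype, geom, fsum_mul]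
  simp only [mul_fsum]
  rw [← fsum_prod fun p : ℕ × {nu // HStrip nu α ∧ HStrip nu β} =>
    (PowerSeries.X ^ ((a + b) * p.1) : PowerSeries ENNReal) *
      PowerSeries.X ^ (b * (β.size - p.2.1.size) + a * (α.size - p.2.1.size)),
    ← fsum_equiv (toggle α β)]
  congr 1
  funext lam
  rw [← pow_add]
  congr 1
  have hs := size_add_size_toggle α β lam
  obtain ⟨c, hc⟩ := Nat.exists_eq_add_of_le (toggle α β lam).2.2.1.size_le
  obtain ⟨d, hd⟩ := Nat.exists_eq_add_of_le (toggle α β lam).2.2.2.size_le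
  rw [show lam.1.size - β.size = c + (toggle α β lam).1 by omega,
    show lam.1.size - α.size = d + (toggle α β lam).1 by omega,
    show β.size - (toggle α β lam).2.1.size = d by omega,
    show α.size - (toggle α β lam).2.1.size = c by omega]
  ring

/-- Summation over the partitions obtained by adding a horizontal strip. -/
noncomputable def up (e : ℕ) (f : Ptn → PowerSeries ENNReal) (mu : Ptn) : PowerSeries ENNReal :=
  fsum fun lam => kernel e mu lam * f lam

/-- Summation over the partitions obtained by removing a horizontal strip. -/
noncomputable def down (e : ℕ) (f : Ptn → PowerSeries ENNReal) (mu : Ptn) : PowerSeries ENNReal :=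
  fsum fun nu => kernel e nu mu * f nu

theorem up_smul (e : ℕ) (c : PowerSeries ENNReal) (f : Ptn → PowerSeries ENNReal) :
    up e (c • f) = c • up e f := by
  funext mu
  simp only [up, Pi.smul_apply, smul_eq_mul, mul_fsum, mul_left_comm]

theorem down_smul (e : ℕ) (c : PowerSeries ENNReal) (f : Ptn → PowerSeries ENNReal) :
    down e (c • f) = c • down e f := by
  funext mu
  simp only [down, Pi.smul_apply, smul_eq_mul, mul_fsum, mul_left_comm]

theorem up_down (a b : ℕ) (f : Ptn → PowerSeries ENNReal) :
    up a (down b f) = geom (a + b) • down b (up a f) := by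
  funext β
  simp only [up, down, Pi.smul_apply, smul_eq_mul]
  calc fsum (fun lam => kernel a β lam * fsum fun α => kernel b α lam * f α)
      = fsum fun α => fsum (fun lam => kernel a β lam * kernel b α lam) * f α := by
        simp only [mul_fsum, fsum_mul, mul_assoc]
        exact fsum_comm _
    _ = geom (a + b) * fsum fun α => fsum (fun nu => kernel b nu β * kernel a nu α) * f α := by
        simp only [fsum_kernel_mul_kernel, mul_assoc]
        rw [mul_fsum]
    _ = geom (a + b) * fsum fun nu => kernel b nu β * fsum fun α => kernel a nu α * f α := by
        congr 1
        simp only [mul_fsum, fsum_mul, mul_assoc]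
        exact fsum_comm _

/-- The reflection relation at the free boundary. -/
theorem up_one (e : ℕ) : up e 1 = geom e • down e 1 := by
  funext mu
  have h := fsum_kernel_mul_kernel e 0 mu mu
  have hk : ∀ a lam, kernel a mu lam * kernel 0 mu lam = kernel a mu lam := fun a lam => by
    by_cases h : HStrip mu lam <;> simp [kernel, h]
  have hk' : ∀ a nu, kernel 0 nu mu * kernel a nu mu = kernel a nu mu := fun a nu => by
    by_cases h : HStrip nu mu <;> simp [kernel, h]
  simpa only [hk, hk', add_zero, up, down, Pi.smul_apply, smul_eq_mul, Pi.one_apply,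
    mul_one] using h

/-- Successive additions of horizontal strips, with exponents taken from a list. -/
noncomputable def upList (l : List ℕ) (f : Ptn → PowerSeries ENNReal) :
    Ptn → PowerSeries ENNReal :=
  l.foldl (fun g e => up e g) f

/-- Successive removals of horizontal strips, with exponents taken from a list. -/
noncomputable def downList (l : List ℕ) (f : Ptn → PowerSeries ENNReal) :
    Ptn → PowerSeries ENNReal :=
  l.foldr down f

theorem upList_concat (l : List ℕ) (x : ℕ) (f : Ptn → PowerSeries ENNReal) :
    upList (l ++ [x]) f = up x (upList l f) :=
  List.foldl_append

theorem upList_smul (l : List ℕ) (c : PowerSeries ENNReal) (f : Ptn → PowerSeries ENNReal) :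
    upList l (c • f) = c • upList l f := by
  induction l generalizing f with
  | nil => rfl
  | cons x l ih => exact (congrArg (upList l) (up_smul x c f)).trans (ih _)

theorem upList_down (l : List ℕ) (x : ℕ) (f : Ptn → PowerSeries ENNReal) :
    upList l (down x f) = (l.map fun y => geom (x + y)).prod • down x (upList l f) := by
  induction l generalizing f with
  | nil => simp [upList]
  | cons y l ih =>
    calc upList l (up y (down x f)) = geom (x + y) • upList l (down x (up y f)) := by
          rw [up_down, upList_smul, add_comm y]
      _ = _ := by
          rw [ih, smul_smul, List.map_cons, List.prod_cons]
          rfl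

/-- The product of Cauchy–Littlewood factors attached to a list of exponents. -/
noncomputable def littlewood : List ℕ → PowerSeries ENNReal
  | [] => 1
  | x :: l => geom x * (l.map fun y => geom (x + y)).prod * littlewood l

theorem upList_one (l : List ℕ) : upList l 1 = littlewood l • downList l 1 := by
  induction l with
  | nil => simp [upList, downList, littlewood]
  | cons x l ih =>
    calc upList l (up x 1) = _ := by
          rw [up_one, upList_smul, upList_down, ih, down_smul, smul_smul, smul_smul]
          rfl

theorem fsum_mul_downList (q : ℕ) (l : List ℕ) (f g : Ptn → PowerSeries ENNReal) :
    fsum (fun mu => PowerSeries.X ^ (q * mu.size) * f mu * downList l g mu) =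
      fsum fun mu => PowerSeries.X ^ (q * mu.size) * upList (l.map (· + q)) f mu * g mu := by
  induction l generalizing f with
  | nil => rfl
  | cons x l ih =>
    refine Eq.trans ?_ (ih (up (x + q) f))
    change fsum (fun mu => PowerSeries.X ^ (q * mu.size) * f mu *
      fsum fun nu => kernel x nu mu * downList l g nu) = fsum (fun nu =>
        PowerSeries.X ^ (q * nu.size) * (fsum fun mu => kernel (x + q) nu mu * f mu) *
          downList l g nu)
    simp only [mul_fsum, fsum_mul]
    rw [fsum_comm]
    congr! 4 with nu mu
    by_cases h : HStrip nu mu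
    · obtain ⟨d, hd⟩ := Nat.exists_eq_add_of_le h.size_le
      simp only [kernel, h, if_true, hd, Nat.add_sub_cancel_left]
      ring
    · simp [kernel, h]

/-- The generating function of sequences of horizontal strips with free boundaries. -/
noncomputable def freeSum (q : ℕ) (l : List ℕ) : PowerSeries ENNReal :=
  fsum fun mu => PowerSeries.X ^ (q * mu.size) * upList l 1 mu

theorem freeSum_eq_littlewood_mul (q : ℕ) (l : List ℕ) :
    freeSum q l = littlewood l * freeSum q (l.map (· + q)) := by
  have h := fsum_mul_downList q l 1 1
  simp only [Pi.one_apply, mul_one] at h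
  rw [freeSum, freeSum, ← h, upList_one, mul_fsum]
  simp only [Pi.smul_apply, smul_eq_mul, mul_left_comm]

theorem freeSum_eq_prod_mul (q : ℕ) (l : List ℕ) (N : ℕ) :
    freeSum q l = (∏ n ∈ Finset.range N, littlewood (l.map (· + n * q))) *
      freeSum q (l.map (· + N * q)) := by
  induction N with
  | zero => simp
  | succ N ih =>
    rw [Finset.prod_range_succ, mul_assoc, ih, freeSum_eq_littlewood_mul q (l.map (· + N * q)),
      List.map_map]
    simp only [Function.comp_def, add_mul, one_mul, add_assoc]

end Operators

section LowDegree

variable {R : Type*} [Semiring R]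

theorem coeff_mul_congr {f f' g g' : PowerSeries R} {k : ℕ}
    (hf : ∀ j ≤ k, PowerSeries.coeff j f = PowerSeries.coeff j f')
    (hg : ∀ j ≤ k, PowerSeries.coeff j g = PowerSeries.coeff j g') :
    PowerSeries.coeff k (f * g) = PowerSeries.coeff k (f' * g') := by
  simp only [PowerSeries.coeff_mul]
  refine Finset.sum_congr rfl fun p hp => ?_
  have := Finset.HasAntidiagonal.mem_antidiagonal.mp hp
  rw [hf _ (by omega), hg _ (by omega)]

end LowDegree

theorem HStrip.refl (mu : Ptn) : HStrip mu mu := fun i => ⟨le_rfl, mu.part_succ_le i⟩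

theorem HStrip.eq_of_size_le {mu lam : Ptn} (h : HStrip mu lam) (hs : lam.size ≤ mu.size) :
    mu = lam := by
  obtain ⟨N, hN⟩ := lam.exists_bound
  have hN' : ∀ i, N ≤ i → mu.part i = 0 := fun i hi =>
    Nat.eq_zero_of_le_zero ((h i).1.trans (hN i hi).le)
  have hsum := le_antisymm h.size_le hs
  rw [lam.size_eq_sum_range hN, mu.size_eq_sum_range hN',
    Finset.sum_eq_sum_iff_of_le fun i _ => (h i).1] at hsum
  ext i
  by_cases hi : i < N
  · exact hsum i (Finset.mem_range.mpr hi)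
  · rw [hN i (not_lt.mp hi), hN' i (not_lt.mp hi)]

theorem coeff_up {e k : ℕ} (hk : k < e) (f : Ptn → PowerSeries ENNReal) (mu : Ptn) :
    PowerSeries.coeff k (up e f mu) = PowerSeries.coeff k (f mu) := by
  rw [up, coeff_fsum, tsum_eq_single mu]
  · simp [kernel, HStrip.refl]
  · intro lam hne
    by_cases h : HStrip mu lam
    · have hlt : 1 ≤ lam.size - mu.size := by
        by_contra hcon
        exact hne (h.eq_of_size_le (by omega)).symm
      have := Nat.le_mul_of_pos_right e hlt
      rw [kernel, if_pos h, PowerSeries.coeff_X_pow_mul', if_neg (by omega)]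
    · simp [kernel, h]

theorem coeff_upList {k : ℕ} (l : List ℕ) (hl : ∀ e ∈ l, k < e)
    (f : Ptn → PowerSeries ENNReal) (mu : Ptn) :
    PowerSeries.coeff k (upList l f mu) = PowerSeries.coeff k (f mu) := by
  induction l generalizing f with
  | nil => rfl
  | cons x l ih =>
    exact (ih (fun e he => hl e (List.mem_cons_of_mem _ he)) _).trans
      (coeff_up (hl x List.mem_cons_self) f mu)

theorem coeff_freeSum {k : ℕ} (q : ℕ) (l : List ℕ) (hl : ∀ e ∈ l, k < e) :
    PowerSeries.coeff k (freeSum q l) =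
      PowerSeries.coeff k (fsum fun mu : Ptn => PowerSeries.X ^ (q * mu.size)) := by
  rw [freeSum, coeff_fsum, coeff_fsum]
  refine tsum_congr fun mu => ?_
  rw [← mul_one (PowerSeries.X ^ (q * mu.size) : PowerSeries ENNReal), mul_assoc, one_mul]
  exact coeff_mul_congr (fun _ _ => rfl) fun j hj =>
    coeff_upList l (fun e he => hj.trans_lt (hl e he)) 1 mu

section AllPartitions

/-- A partition is determined by the difference of its first two parts and the partition formed by
the other parts. -/
noncomputable def Ptn.tailEquiv : Ptn ≃ ℕ × Ptn where
  toFun lam := ⟨lam.part 0 - lam.part 1,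
    Ptn.ofFun (fun i => lam.part (i + 1)) (fun i => lam.part_succ_le (i + 1)) lam
      fun i => lam.antitone' (by omega)⟩
  invFun p := Ptn.ofFun (fun i => Nat.casesOn i (p.2.part 0 + p.1) p.2.part)
    (fun i => by
      cases i with
      | zero => exact Nat.le_add_right _ _
      | succ j => exact p.2.part_succ_le j) p.2 fun i => le_rfl
  left_inv lam := by
    ext i
    cases i with
    | zero => exact Nat.add_sub_cancel' (lam.part_succ_le 0)
    | succ j => rfl
  right_inv p := Prod.ext (Nat.add_sub_cancel_left _ _) (Ptn.ext fun i => rfl)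

theorem Ptn.size_tailEquiv (lam : Ptn) :
    lam.size = (Ptn.tailEquiv lam).2.size + lam.part 0 := by
  obtain ⟨N, hN⟩ := lam.exists_bound
  rw [lam.size_eq_sum_range (N := N + 1) fun i hi => hN i (by omega),
    (Ptn.tailEquiv lam).2.size_eq_sum_range (N := N) fun i hi => hN (i + 1) (by omega),
    Finset.sum_range_succ']
  rfl

theorem Ptn.part_zero_tailEquiv (lam : Ptn) :
    lam.part 0 = (Ptn.tailEquiv lam).2.part 0 + (Ptn.tailEquiv lam).1 :=
  (Nat.add_sub_cancel' (lam.part_succ_le 0)).symm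

/-- The generating function of partitions where the largest part has additional weight `N`. -/
noncomputable def partitionSum (q N : ℕ) : PowerSeries ENNReal :=
  fsum fun mu : Ptn => PowerSeries.X ^ (q * (mu.size + N * mu.part 0))

theorem partitionSum_eq_geom_mul (q N : ℕ) :
    partitionSum q N = geom (q * (N + 1)) * partitionSum q (N + 1) := by
  simp only [partitionSum, geom, fsum_mul, mul_fsum]
  rw [fsum_comm, ← fsum_prod fun p : ℕ × Ptn => (PowerSeries.X ^ (q * (N + 1) * p.1) *
    PowerSeries.X ^ (q * (p.2.size + (N + 1) * p.2.part 0)) : PowerSeries ENNReal),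
    ← fsum_equiv Ptn.tailEquiv]
  congr 1
  funext lam
  rw [← pow_add]
  congr 1
  rw [lam.size_tailEquiv, lam.part_zero_tailEquiv]
  ring

theorem partitionSum_eq_prod_mul (q N : ℕ) :
    partitionSum q 0 = (∏ n ∈ Finset.range N, geom (q * (n + 1))) * partitionSum q N := by
  induction N with
  | zero => simp
  | succ N ih => rw [Finset.prod_range_succ, mul_assoc, ih, partitionSum_eq_geom_mul q N]

theorem coeff_partitionSum {q N k : ℕ} (hq : 1 ≤ q) (hk : k < N) :
    PowerSeries.coeff k (partitionSum q N) = PowerSeries.coeff k 1 := by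
  let o : Ptn := ⟨0, fun _ _ _ => le_rfl⟩
  have ho : o.size = 0 := Finsupp.sum_zero_index
  rw [partitionSum, coeff_fsum, tsum_eq_single o]
  · rw [ho, show o.part 0 = 0 from rfl, mul_zero, add_zero, mul_zero, pow_zero]
  · intro mu hmu
    have h0 : 1 ≤ mu.part 0 := by
      by_contra hcon
      refine hmu (Ptn.ext fun i => ?_)
      have h1 : mu.part i ≤ mu.part 0 := mu.antitone' (Nat.zero_le i)
      have h2 : o.part i = 0 := rfl
      omega
    have h1 := Nat.le_mul_of_pos_right N h0
    have h2 := Nat.le_mul_of_pos_left (mu.size + N * mu.part 0) hq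
    rw [PowerSeries.coeff_X_pow, if_neg (by omega)]

end AllPartitions

theorem coeff_freeSum_eq_coeff_prod {q N k : ℕ} (hq : 1 ≤ q) (l : List ℕ) (hk : k < N) :
    PowerSeries.coeff k (freeSum q l) =
      PowerSeries.coeff k ((∏ n ∈ Finset.range N, littlewood (l.map (· + n * q))) *
        ∏ n ∈ Finset.range N, geom (q * (n + 1))) := by
  rw [freeSum_eq_prod_mul q l N]
  refine coeff_mul_congr (fun _ _ => rfl) fun j hj => ?_
  have hN := Nat.le_mul_of_pos_right N hq
  rw [coeff_freeSum q _ fun e he => ?_]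
  · have h0 : (fsum fun mu : Ptn => PowerSeries.X ^ (q * mu.size)) = partitionSum q 0 := by
      simp only [partitionSum, zero_mul, add_zero]
    rw [h0, partitionSum_eq_prod_mul q N, ← mul_one (∏ n ∈ Finset.range N, geom (q * (n + 1))),
      mul_assoc, one_mul]
    exact coeff_mul_congr (fun _ _ => rfl) fun i hi => coeff_partitionSum hq (by omega)
  · obtain ⟨x, -, rfl⟩ := List.mem_map.mp he
    omega

section Unfolding

theorem isDSPP_snoc {n : ℕ} (L : Fin (n + 1) → Ptn) (mu : Ptn) :
    IsDSPP (n + 2) (fun _ => -1) (Fin.snoc (α := fun _ => Ptn) L mu) ↔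
      IsDSPP (n + 1) (fun _ => -1) L ∧ HStrip mu (L (Fin.last n)) := by
  have hlast : ∀ h, Fin.snoc (α := fun _ => Ptn) L mu ⟨n + 1, h⟩ = mu := fun h =>
    Fin.snoc_last (α := fun _ => Ptn) mu L
  have hinit : ∀ i (h : i < n + 1) h', Fin.snoc (α := fun _ => Ptn) L mu ⟨i, h'⟩ = L ⟨i, h⟩ :=
    fun i h h' => Fin.snoc_castSucc (α := fun _ => Ptn) mu L ⟨i, h⟩
  simp only [IsDSPP, show ¬ ((-1 : ℤ) = 1) by decide, if_false]
  constructor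
  · intro h
    refine ⟨fun i hi => ?_, ?_⟩
    · have := h i (by omega)
      rwa [hinit (i + 1) hi, hinit i (by omega)] at this
    · have := h n (by omega)
      rwa [hlast, hinit n (by omega)] at this
  · rintro ⟨h1, h2⟩ i hi
    rcases Nat.lt_or_ge (i + 1) (n + 1) with h | h
    · rw [hinit (i + 1) h, hinit i (by omega)]
      exact h1 i h
    · obtain rfl : i = n := by omega
      rw [hlast, hinit i (by omega)]
      exact h2

open Classical in
theorem fsum_isDSPP (n : ℕ) (g : Ptn → PowerSeries ENNReal) :
    fsum (fun L : Fin (n + 1) → Ptn => if IsDSPP (n + 1) (fun _ => -1) L then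
        PowerSeries.X ^ (∑ i, (L i).size) * g (L (Fin.last n)) else 0) =
      fsum fun mu => PowerSeries.X ^ ((n + 1) * mu.size) * upList (List.range' 1 n) 1 mu * g mu := by
  induction n generalizing g with
  | zero =>
    rw [← fsum_equiv (Equiv.funUnique (Fin 1) Ptn)]
    congr 1
    funext L
    have hL : IsDSPP (0 + 1) (fun _ => -1) L := fun i hi => by omega
    rw [if_pos hL]
    simp [upList]
  | succ n ih =>
    rw [← fsum_equiv (Fin.snocEquiv fun _ : Fin (n + 2) => Ptn), fsum_prod, fsum_comm]
    let g' : Ptn → PowerSeries ENNReal := fun nu => fsum fun mu =>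
      if HStrip mu nu then PowerSeries.X ^ mu.size * g mu else 0
    refine Eq.trans ?_ ((ih g').trans ?_)
    · congr 1
      funext L
      by_cases hL : IsDSPP (n + 1) (fun _ => -1) L
      · rw [if_pos hL, mul_fsum]
        congr 1
        funext mu
        by_cases h : HStrip mu (L (Fin.last n))
        · simp [Fin.snocEquiv, isDSPP_snoc, hL, h, Fin.sum_univ_castSucc, pow_add, mul_assoc]
        · simp [Fin.snocEquiv, isDSPP_snoc, h]
      · rw [if_neg hL]
        ext k
        simp [coeff_fsum, Fin.snocEquiv, isDSPP_snoc, hL]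
    · simp only [g', mul_fsum]
      rw [fsum_comm]
      congr 1
      funext mu
      rw [List.range'_1_concat, upList_concat]
      change _ = PowerSeries.X ^ ((n + 1 + 1) * mu.size) *
        (fsum fun nu => kernel (1 + n) mu nu * upList (List.range' 1 n) 1 nu) * g mu
      simp only [mul_fsum, fsum_mul]
      congr 1
      funext nu
      by_cases h : HStrip mu nu
      · obtain ⟨d, hd⟩ := Nat.exists_eq_add_of_le h.size_le
        simp only [kernel, h, if_true, hd, Nat.add_sub_cancel_left]
        ring
      · simp [kernel, h]

theorem fsum_dspp (n : ℕ) :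
    fsum (fun ω : {L : Fin (n + 1) → Ptn // IsDSPP (n + 1) (fun _ => -1) L} =>
      PowerSeries.X ^ (∑ i, (ω.1 i).size)) = freeSum (n + 1) (List.range' 1 n) := by
  classical
  have h := fsum_isDSPP n 1
  simp only [Pi.one_apply, mul_one] at h
  rw [freeSum, ← h, fsum_subtype]

end Unfolding

section FactorProduct

variable {M : Type*} [CommMonoid M]

/-- The pairs `1 ≤ i < j ≤ m - 1`. -/
abbrev strictPairs (m : ℕ) : Finset (ℕ × ℕ) :=
  ((Finset.Icc 1 (m - 1)) ×ˢ (Finset.Icc 1 (m - 1))).filter (fun q => q.1 < q.2)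

/-- The truncation of the product side, with factors `f e` in place of `(1 - X ^ e)⁻¹`. -/
def factorProd (f : ℕ → M) (m N : ℕ) : M :=
  (∏ k ∈ Finset.range (m * N), f (k + 1)) *
    ∏ k ∈ Finset.range N, ∏ q ∈ strictPairs m, f (2 * m * k + q.1 + q.2)

theorem factorProd_congr {f g : ℕ → M} (h : ∀ e, 0 < e → f e = g e) (m N : ℕ) :
    factorProd f m N = factorProd g m N := by
  unfold factorProd
  congr 1
  · exact Finset.prod_congr rfl fun k _ => h _ k.succ_pos
  · refine Finset.prod_congr rfl fun k _ => Finset.prod_congr rfl fun q hq => h _ ?_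
    simp only [Finset.mem_filter, Finset.mem_product, Finset.mem_Icc] at hq
    omega

theorem map_factorProd {M' F : Type*} [CommMonoid M'] [FunLike F M M'] [MonoidHomClass F M M']
    (φ : F) (f : ℕ → M) (m N : ℕ) :
    φ (factorProd f m N) = factorProd (fun e => φ (f e)) m N := by
  simp only [factorProd, map_mul, map_prod]

theorem prod_strictPairs (m : ℕ) (f : ℕ → ℕ → M) :
    ∏ q ∈ strictPairs m, f q.1 q.2 = ∏ i ∈ Finset.Ico 1 m, ∏ j ∈ Finset.Ioo i m, f i j := by
  rw [Finset.prod_sigma']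
  refine Finset.prod_bij' (fun q _ => ⟨q.1, q.2⟩) (fun s _ => (s.1, s.2)) ?_ ?_ ?_ ?_ ?_
  · simp only [Finset.mem_filter, Finset.mem_product, Finset.mem_Icc, Finset.mem_sigma,
      Finset.mem_Ico, Finset.mem_Ioo]
    intro q hq
    omega
  · simp only [Finset.mem_filter, Finset.mem_product, Finset.mem_Icc, Finset.mem_sigma,
      Finset.mem_Ico, Finset.mem_Ioo]
    intro q hq
    omega
  all_goals intros; rfl

end FactorProduct

theorem littlewood_range' (a n c : ℕ) :
    littlewood ((List.range' a n).map (· + c)) = (∏ i ∈ Finset.Ico a (a + n), geom (i + c)) *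
      ∏ i ∈ Finset.Ico a (a + n), ∏ j ∈ Finset.Ioo i (a + n), geom (2 * c + i + j) := by
  induction n generalizing a with
  | zero => simp [littlewood]
  | succ n ih =>
    have hlist : ∀ (b k : ℕ) (f : ℕ → PowerSeries ENNReal),
        ((List.range' b k).map f).prod = ∏ j ∈ Finset.Ico b (b + k), f j := fun b k f => by
      induction k generalizing b with
      | zero => simp
      | succ k ih =>
        rw [List.range'_succ, List.map_cons, List.prod_cons, ih,
          Finset.prod_eq_prod_Ico_succ_bot (show b < b + (k + 1) by omega),
          show b + 1 + k = b + (k + 1) by omega]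
    rw [List.range'_succ, List.map_cons, littlewood, ih, List.map_map, hlist, mul_assoc,
      mul_left_comm (Finset.prod _ _), ← mul_assoc,
      Finset.prod_eq_prod_Ico_succ_bot (show a < a + (n + 1) by omega),
      Finset.prod_eq_prod_Ico_succ_bot (show a < a + (n + 1) by omega),
      show a + 1 + n = a + (n + 1) by omega, ← Finset.Ico_add_one_left_eq_Ioo]
    have hc : ∀ j, geom (2 * c + a + j) = geom (a + c + (j + c)) := fun j => by
      congr 1
      ring
    simp only [hc, Function.comp_apply]

theorem prod_littlewood_mul_prod_geom {m : ℕ} (hm : 1 ≤ m) (N : ℕ) :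
    (∏ n ∈ Finset.range N, littlewood ((List.range' 1 (m - 1)).map (· + n * m))) *
      ∏ n ∈ Finset.range N, geom (m * (n + 1)) = factorProd geom m N := by
  induction N with
  | zero => simp [factorProd]
  | succ N ih =>
    rw [Finset.prod_range_succ, Finset.prod_range_succ, mul_mul_mul_comm, ih, littlewood_range',
      factorProd, factorProd, Finset.prod_range_succ, mul_add_one, Finset.prod_range_add,
      prod_strictPairs m fun i j => geom (2 * m * N + i + j), Nat.add_sub_cancel' hm]
    obtain ⟨n, rfl⟩ := Nat.exists_eq_add_of_le' hm
    rw [Finset.prod_range_succ (fun i => geom ((n + 1) * N + i + 1)) n, Finset.prod_Ico_eq_prod_range]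
    have h1 : ∀ i, geom (1 + i + N * (n + 1)) = geom ((n + 1) * N + i + 1) := fun i => by
      congr 1
      ring
    have h2 : 2 * (N * (n + 1)) = 2 * (n + 1) * N := by ring
    have h3 : (n + 1) * N + n + 1 = (n + 1) * N + (n + 1) := rfl
    simp only [h1, h2, h3, Nat.add_sub_cancel]
    ac_rfl

theorem coeff_freeSum_eq_coeff_factorProd {m N k : ℕ} (hm : 1 ≤ m) (hk : k < N) :
    PowerSeries.coeff k (freeSum m (List.range' 1 (m - 1))) =
      PowerSeries.coeff k (factorProd geom m N) := by
  rw [coeff_freeSum_eq_coeff_prod hm _ hk, prod_littlewood_mul_prod_geom hm]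

section Transfer

/-- The geometric series `∑ₖ X ^ (e k)` for positive `e`, over any semiring. -/
noncomputable def divisorSeries (R : Type*) [Semiring R] (e : ℕ) : PowerSeries R :=
  PowerSeries.mk fun k => if e ∣ k then 1 else 0

theorem map_divisorSeries {R S : Type*} [Semiring R] [Semiring S] (φ : R →+* S) (e : ℕ) :
    PowerSeries.map φ (divisorSeries R e) = divisorSeries S e := by
  ext k
  simp only [divisorSeries, PowerSeries.coeff_map, PowerSeries.coeff_mk]
  split_ifs <;> simp

theorem geom_eq_divisorSeries {e : ℕ} (he : 0 < e) : geom e = divisorSeries ENNReal e := by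
  ext k
  simp only [geom, divisorSeries, coeff_fsum, PowerSeries.coeff_mk, PowerSeries.coeff_X_pow]
  split_ifs with h
  · obtain ⟨d, rfl⟩ := h
    rw [tsum_eq_single d]
    · simp
    · intro j hj
      rw [if_neg fun h => hj (Nat.eq_of_mul_eq_mul_left he h).symm]
  · exact ENNReal.tsum_eq_zero.mpr fun d => if_neg fun hd => h ⟨d, hd⟩

theorem divisorSeries_eq_inv {K : Type*} [Field K] {e : ℕ} (he : 0 < e) :
    divisorSeries K e = (1 - PowerSeries.X ^ e)⁻¹ := by
  rw [PowerSeries.eq_inv_iff_mul_eq_one (by simp [he.ne'])]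
  ext k
  rw [mul_sub, mul_one, map_sub, PowerSeries.coeff_mul_X_pow', PowerSeries.coeff_one]
  simp only [divisorSeries, PowerSeries.coeff_mk]
  rcases Nat.eq_zero_or_pos k with rfl | hk
  · simp [he.ne']
  · by_cases hek : e ≤ k
    · have hdvd : e ∣ k - e ↔ e ∣ k := by
        rw [Nat.dvd_sub_iff_left hek dvd_rfl]
      simp [hek, hk.ne', hdvd]
    · rw [if_neg fun h => hek (Nat.le_of_dvd hk h), if_neg hek, if_neg hk.ne', sub_zero]

theorem factorProd_geom (m N : ℕ) :
    factorProd geom m N =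
      PowerSeries.map (Nat.castRingHom ENNReal) (factorProd (divisorSeries ℕ) m N) := by
  simp only [map_factorProd, map_divisorSeries]
  exact factorProd_congr (fun e => geom_eq_divisorSeries) m N

theorem factorProd_inv (K : Type*) [Field K] (m N : ℕ) :
    factorProd (fun e => (1 - PowerSeries.X ^ e : PowerSeries K)⁻¹) m N =
      PowerSeries.map (Nat.castRingHom K) (factorProd (divisorSeries ℕ) m N) := by
  simp only [map_factorProd, map_divisorSeries]
  exact factorProd_congr (fun e he => (divisorSeries_eq_inv he).symm) m N

theorem hasSum_ite_of_tsum_ite {ι : Type*} (p : ι → Prop) [DecidablePred p] (a : ℕ)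
    (h : ∑' i, (if p i then 1 else 0 : ENNReal) = a) :
    HasSum (fun i => (if p i then 1 else 0 : ℚ)) a := by
  have h1 : ({i | p i}.encard : ENNReal) = a := by
    rw [← ENNReal.tsum_set_one, ← h, tsum_subtype {i | p i} fun _ => (1 : ENNReal)]
    refine tsum_congr fun i => ?_
    by_cases hi : p i <;> simp [hi]
  have h2 : {i | p i}.encard = a := by exact_mod_cast h1
  have hfin : {i | p i}.Finite := Set.finite_of_encard_eq_coe h2
  have h3 : hfin.toFinset.card = a := by
    rw [hfin.encard_eq_coe_toFinset_card] at h2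
    exact_mod_cast h2
  have hs : ∑ i ∈ hfin.toFinset, (if p i then 1 else 0 : ℚ) = a := by
    rw [← h3, Finset.card_eq_sum_ones, Nat.cast_sum]
    refine Finset.sum_congr rfl fun i hi => ?_
    have hi' : p i := hfin.mem_toFinset.mp hi
    rw [if_pos hi', Nat.cast_one]
  rw [← hs]
  refine hasSum_sum_of_ne_finset_zero fun i hi => if_neg fun h => hi (hfin.mem_toFinset.mpr h)

end Transfer

section Topology

theorem coeff_sum_dspp {m k N : ℕ} (hm : 1 ≤ m) (hk : k < N) :
    ∑' ω : {L : Fin m → Ptn // IsDSPP m (fun _ => -1) L},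
        (if k = ∑ i, (ω.1 i).size then 1 else 0 : ENNReal) =
      PowerSeries.coeff k (factorProd (divisorSeries ℕ) m N) := by
  have h := coeff_freeSum_eq_coeff_factorProd hm hk
  obtain ⟨n, rfl⟩ := Nat.exists_eq_add_of_le' hm
  rw [factorProd_geom, Nat.add_sub_cancel, ← fsum_dspp, coeff_fsum, PowerSeries.coeff_map] at h
  simpa only [PowerSeries.coeff_X_pow, Nat.coe_castRingHom] using h

theorem hasSum_dspp {m : ℕ} (hm : 1 ≤ m) :
    HasSum (fun ω : {L : Fin m → Ptn // IsDSPP m (fun _ => -1) L} => z ^ (∑ i, (ω.1 i).size))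
      (PowerSeries.mk fun k => (PowerSeries.coeff k
        (factorProd (fun e => (1 - z ^ e)⁻¹) m (k + 1)))) := by
  refine (PowerSeries.WithPiTopology.hasSum_iff_hasSum_coeff ℚ).mpr fun k => ?_
  simp only [z, PowerSeries.coeff_X_pow, PowerSeries.coeff_mk, factorProd_inv,
    PowerSeries.coeff_map]
  exact hasSum_ite_of_tsum_ite _ _ (coeff_sum_dspp hm k.lt_succ_self)

theorem coeff_factorProd_inv {m k N : ℕ} (hm : 1 ≤ m) (hk : k < N) :
    PowerSeries.coeff k (factorProd (fun e => (1 - z ^ e)⁻¹) m N) =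
      PowerSeries.coeff k (factorProd (fun e => (1 - z ^ e)⁻¹) m (k + 1)) := by
  have h := (coeff_sum_dspp hm hk).symm.trans (coeff_sum_dspp hm k.lt_succ_self)
  simp only [z, factorProd_inv, PowerSeries.coeff_map]
  exact congrArg _ (by exact_mod_cast h)

theorem tendsto_factorProd {m : ℕ} (hm : 1 ≤ m) :
    Filter.Tendsto (fun N => factorProd (fun e => (1 - z ^ e)⁻¹) m N) Filter.atTop
      (nhds (PowerSeries.mk fun k => (PowerSeries.coeff k
        (factorProd (fun e => (1 - z ^ e)⁻¹) m (k + 1))))) := by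
  refine (PowerSeries.WithPiTopology.tendsto_iff_coeff_tendsto ℚ _ _ _).mpr fun k => ?_
  rw [PowerSeries.coeff_mk]
  refine tendsto_const_nhds.congr' ?_
  filter_upwards [Filter.eventually_gt_atTop k] with N hN
  exact (coeff_factorProd_inv hm hN).symm

theorem multipliable_of_X_pow_dvd_sub_one (f : ℕ → PowerSeries ℚ)
    (h : ∀ n, PowerSeries.X ^ n ∣ f n - 1) : Multipliable f := by
  have hord : Filter.Tendsto (fun n => (f n - 1).order) Filter.atTop (nhds ⊤) := by
    refine ENat.tendsto_nhds_top_iff_natCast_lt.mpr fun n => ?_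
    filter_upwards [Filter.eventually_gt_atTop n] with k hk
    exact (Nat.cast_lt.mpr hk).trans_le (PowerSeries.nat_le_order _ k (PowerSeries.X_pow_dvd_iff.mp (h k)))
  have := PowerSeries.WithPiTopology.multipliable_one_add_of_tendsto_order_atTop_nhds_top ℚ hord
  simp only [add_sub_cancel] at this
  exact this

theorem X_pow_dvd_inv_sub_one {n e : ℕ} (he : 0 < e) (h : n ≤ e) :
    (PowerSeries.X ^ n : PowerSeries ℚ) ∣ (1 - z ^ e)⁻¹ - 1 := by
  have hc : PowerSeries.constantCoeff (1 - z ^ e) ≠ 0 := by simp [z, he.ne']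
  refine (pow_dvd_pow _ h).trans ⟨(1 - z ^ e)⁻¹, ?_⟩
  have := PowerSeries.mul_inv_cancel _ hc
  rw [sub_mul, one_mul] at this
  exact sub_eq_of_eq_add' (sub_eq_iff_eq_add.mp this)

theorem X_pow_dvd_prod_sub_one {ι : Type*} (n : ℕ) (s : Finset ι) (f : ι → PowerSeries ℚ)
    (h : ∀ i ∈ s, PowerSeries.X ^ n ∣ f i - 1) : PowerSeries.X ^ n ∣ ∏ i ∈ s, f i - 1 := by
  classical
  induction s using Finset.induction_on with
  | empty => simp
  | insert i s hi ih =>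
    rw [Finset.prod_insert hi, show f i * ∏ j ∈ s, f j - 1 =
      (f i - 1) * ∏ j ∈ s, f j + (∏ j ∈ s, f j - 1) by ring]
    exact dvd_add ((h i (Finset.mem_insert_self i s)).mul_right _)
      (ih fun j hj => h j (Finset.mem_insert_of_mem hj))

end Topology

/-- **Theorem 1.1**: the generating function for doubled shifted plane
partitions of width `m` (i.e. skew doubled shifted plane partitions with
profile `δ = (-1)^{m-1}`) is
`Σ_{ω ∈ DSPP_m} z^{|ω|}
  = ∏_{k≥1} (1-z^k)⁻¹ · ∏_{k≥0} ∏_{1≤i<j≤m-1} (1 - z^{2mk+i+j})⁻¹`. -/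
theorem gf_doubled_shifted_plane_partitions (m : ℕ) (hm : 1 ≤ m) :
    ∑' ω : {L : Fin m → Ptn // IsDSPP m (fun _ => -1) L},
      z ^ (∑ i, (ω.1 i).size)
    = (∏' k : ℕ, (1 - z ^ (k + 1))⁻¹) *
        ∏' k : ℕ,
          ∏ q ∈ ((Finset.Icc 1 (m - 1)) ×ˢ (Finset.Icc 1 (m - 1))).filter
              (fun q => q.1 < q.2),
            (1 - z ^ (2 * m * k + q.1 + q.2))⁻¹ := by
  have h1 : Multipliable fun k : ℕ => (1 - z ^ (k + 1))⁻¹ :=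
    multipliable_of_X_pow_dvd_sub_one _ fun k =>
      X_pow_dvd_inv_sub_one k.succ_pos (Nat.le_succ k)
  have h2 : Multipliable fun k : ℕ =>
      ∏ q ∈ strictPairs m, (1 - z ^ (2 * m * k + q.1 + q.2))⁻¹ := by
    refine multipliable_of_X_pow_dvd_sub_one _ fun k => X_pow_dvd_prod_sub_one _ _ _ fun q hq => ?_
    have hk : k ≤ 2 * m * k := Nat.le_mul_of_pos_left k (by omega)
    simp only [Finset.mem_filter, Finset.mem_product, Finset.mem_Icc] at hq
    exact X_pow_dvd_inv_sub_one (by omega) (by omega)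
  have : T2Space (PowerSeries ℚ) := PowerSeries.WithPiTopology.instT2Space ℚ
  have : ContinuousMul (PowerSeries ℚ) :=
    (PowerSeries.WithPiTopology.instIsTopologicalSemiring ℚ).toContinuousMul
  have hmul : Filter.Tendsto (fun N => m * N) Filter.atTop Filter.atTop :=
    Filter.tendsto_id.const_mul_atTop' hm
  rw [(hasSum_dspp hm).tsum_eq]
  exact tendsto_nhds_unique (tendsto_factorProd hm)
    ((h1.hasProd.tendsto_prod_nat.comp hmul).mul h2.hasProd.tendsto_prod_nat)
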